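/- Let N = ⊕_{j=1}^d N_j be a graded admissible algebra, π the projection onto N_d = Ann(N) with kernel ⊕_{j<d} N_j, and f = π ∘ exp₁ : N → N_d. Then the group A(f) of affine transformations g of N satisfying f ∘ g = f acts transitively on S := f^{-1}(0). In particular, S is an affinely homogeneous hypersurface. -/

import Mathlib

open Finset

/-- Annihilator `Ann(N) = {u ∈ N : uN = 0}` of a non-unital commutative ℂ-algebra. -/
def annN (N : Type*) [NonUnitalCommRing N] [Module ℂ N] [IsScalarTower ℂ N N] :
    Submodule ℂ N where
  carrier := {u | ∀ v : N, u * v = 0}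
  add_mem' := fun ha hb v => by rw [add_mul, ha v, hb v, add_zero]
  zero_mem' := fun v => zero_mul v
  smul_mem' := fun c a ha v => by rw [smul_mul_assoc, ha v, smul_zero]

/-- The descending chain of ideals: `npow N j` is `N^j` for `j ≥ 1`
(`N^1 = N`, `N^{j+1} = span(N·N^j)`; `npow N 0 := ⊤` by convention). -/
def npow (N : Type*) [NonUnitalCommRing N] [Module ℂ N] : ℕ → Submodule ℂ N
  | 0 => ⊤
  | 1 => ⊤
  | (j+2) => Submodule.span ℂ {x : N | ∃ u : N, ∃ v ∈ npow N (j+1), x = u * v}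

/-- Powers `u^m` of an element in a non-unital commutative ring
(`upow u 0 := 0` by convention; only `m ≥ 1` is used). -/
def upow {N : Type*} [NonUnitalCommRing N] (u : N) : ℕ → N
  | 0 => 0
  | 1 => u
  | (m+2) => u * upow u (m+1)

open Polynomial

/-- A grading of a `ℂ`-algebra in degrees `0, …, d`, encoded by the algebra map
`x ↦ ∑ j, x_j X ^ j`, whose coefficients are the homogeneous components. -/
structure IsGradingMap {A : Type*} [CommRing A] [Algebra ℂ A] (θ : A →ₐ[ℂ] A[X]) (d : ℕ) :
    Prop where
  eval_one : ∀ x, (θ x).eval 1 = x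
  map_coeff : ∀ x j, θ ((θ x).coeff j) = monomial j ((θ x).coeff j)
  natDegree_le : ∀ x, (θ x).natDegree ≤ d

namespace IsGradingMap

variable {A : Type*} [CommRing A] [Algebra ℂ A] {θ : A →ₐ[ℂ] A[X]} {d : ℕ}

theorem sum_coeff (h : IsGradingMap θ d) (x : A) :
    ∑ j ∈ range (d + 1), (θ x).coeff j = x := by
  conv_rhs => rw [← h.eval_one x, eval_eq_sum_range' (Nat.lt_succ_of_le (h.natDegree_le x))]
  simp

@[elab_as_elim]
theorem induction_on (h : IsGradingMap θ d) {P : A → Prop} (x : A)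
    (hadd : ∀ y z, P y → P z → P (y + z)) (hzero : P 0)
    (hom : ∀ j ≤ d, ∀ y, θ y = monomial j y → P y) : P x := by
  rw [← h.sum_coeff x]
  refine Finset.sum_induction _ P hadd hzero fun j hj => ?_
  exact hom j (Nat.lt_succ_iff.mp (mem_range.mp hj)) _ (h.map_coeff x j)

theorem eq_coeff_zero (h : IsGradingMap θ d) {x : A} (hx : ∀ j, 1 ≤ j → (θ x).coeff j = 0) :
    x = (θ x).coeff 0 := by
  conv_lhs => rw [← h.sum_coeff x, sum_range_succ']
  simp [hx]

theorem pow_eq_zero (h : IsGradingMap θ d) {n : A} (hn : (θ n).coeff 0 = 0) :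
    n ^ (d + 1) = 0 := by
  have hdvd : X ^ (d + 1) ∣ θ (n ^ (d + 1)) := by
    rw [map_pow]; exact pow_dvd_pow_of_dvd (X_dvd_iff.mpr hn) _
  rw [← h.sum_coeff (n ^ (d + 1))]
  exact sum_eq_zero fun j hj => X_pow_dvd_iff.mp hdvd j (mem_range.mp hj)

theorem isNilpotent (h : IsGradingMap θ d) {n : A} (hn : (θ n).coeff 0 = 0) :
    IsNilpotent n := ⟨_, h.pow_eq_zero hn⟩

/-- The Euler derivation, multiplying the component of degree `j` by `j`. -/
noncomputable def euler (h : IsGradingMap θ d) : Derivation ℂ A A :=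
  Derivation.mk'
    { toFun := fun x => (derivative (θ x)).eval 1
      map_add' := fun x y => by simp
      map_smul' := fun c x => by simp }
    fun x y => by
      simp only [LinearMap.coe_mk, AddHom.coe_mk, map_mul, derivative_mul, eval_add, eval_mul,
        h.eval_one, smul_eq_mul]
      ring

theorem euler_apply (h : IsGradingMap θ d) (x : A) :
    h.euler x = (derivative (θ x)).eval 1 := rfl

theorem euler_of_homogeneous (h : IsGradingMap θ d) {j : ℕ} {y : A} (hy : θ y = monomial j y) :
    h.euler y = j * y := by
  simp [euler_apply, hy, derivative_monomial, mul_comm]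

theorem coeff_euler (h : IsGradingMap θ d) (x : A) (j : ℕ) :
    (θ (h.euler x)).coeff j = j * (θ x).coeff j := by
  refine h.induction_on x (fun y z hy hz => ?_) ?_ fun i _ y hy => ?_
  · simp only [map_add, coeff_add, hy, hz, mul_add]
  · simp
  · rw [h.euler_of_homogeneous hy, map_mul, map_natCast, hy, ← C_eq_natCast, coeff_C_mul,
      coeff_monomial]
    split_ifs with hij
    · rw [hij]
    · simp

theorem euler_exp [Module ℚ A] (h : IsGradingMap θ d) {a : A} (ha : IsNilpotent a) :
    h.euler (IsNilpotent.exp a) = IsNilpotent.exp a * h.euler a := by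
  obtain ⟨k, hk⟩ := ha
  have hk' : a ^ (k + 1) = 0 := by rw [pow_succ, hk, zero_mul]
  rw [congrArg h.euler (IsNilpotent.exp_eq_sum hk'), IsNilpotent.exp_eq_sum hk, map_sum,
    sum_range_succ', sum_mul]
  simp only [map_rat_smul, Derivation.leibniz_pow]
  simp only [zero_smul, smul_zero, add_zero, Nat.add_sub_cancel]
  refine sum_congr rfl fun i _ => ?_
  rw [← Nat.cast_smul_eq_nsmul ℚ, smul_smul, smul_eq_mul, smul_mul_assoc, Nat.factorial_succ]
  congr 1
  push_cast
  field_simp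

theorem coeff_zero_exp [Module ℚ A] (h : IsGradingMap θ d) {a : A} (ha : (θ a).coeff 0 = 0) :
    (θ (IsNilpotent.exp a)).coeff 0 = 1 := by
  have := (h.isNilpotent ha).map_exp (constantCoeff.comp θ.toRingHom)
  simpa [ha] using this

theorem exists_euler_eq (h : IsGradingMap θ d) {y : A} (hy : (θ y).coeff 0 = 0) :
    ∃ a, (θ a).coeff 0 = 0 ∧ h.euler a = y := by
  refine ⟨∑ j ∈ range (d + 1), (j : ℂ)⁻¹ • (θ y).coeff j, ?_, ?_⟩
  · rw [map_sum, finsetSum_coeff]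
    refine sum_eq_zero fun j _ => ?_
    rw [map_smul, coeff_smul, h.map_coeff, coeff_monomial]
    split_ifs with hj
    · simp [hj]
    · simp
  · conv_rhs => rw [← h.sum_coeff y]
    rw [map_sum]
    refine sum_congr rfl fun j _ => ?_
    rw [Derivation.map_smul, h.euler_of_homogeneous (h.map_coeff y j)]
    rcases eq_or_ne j 0 with rfl | hj
    · simp [hy]
    · rw [← nsmul_eq_mul, ← Nat.cast_smul_eq_nsmul ℂ, inv_smul_smul₀ (by exact_mod_cast hj)]

theorem exists_exp_eq [Module ℚ A] (h : IsGradingMap θ d) {s : A} (hs : (θ s).coeff 0 = 1) :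
    ∃ a, (θ a).coeff 0 = 0 ∧ IsNilpotent.exp a = s := by
  have hunit : IsUnit s := by
    have : IsNilpotent (s - 1) := h.isNilpotent (by simp [hs])
    simpa using this.isUnit_one_add
  obtain ⟨t, ht⟩ := hunit.exists_right_inv
  obtain ⟨a, ha, hDa⟩ := h.exists_euler_eq (y := h.euler s * t)
    (by rw [map_mul, mul_coeff_zero, h.coeff_euler]; simp)
  have hnil := h.isNilpotent ha
  refine ⟨a, ha, ?_⟩
  have hD : h.euler (IsNilpotent.exp (-a) * s) = 0 := by
    rw [Derivation.leibniz, h.euler_exp hnil.neg, map_neg, hDa, smul_eq_mul, smul_eq_mul]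
    linear_combination (-IsNilpotent.exp (-a) * h.euler s) * ht
  have hone : IsNilpotent.exp (-a) * s = 1 := by
    rw [h.eq_coeff_zero (x := IsNilpotent.exp (-a) * s) fun j hj => ?_, map_mul, mul_coeff_zero, hs,
      h.coeff_zero_exp (by simp [ha]), mul_one]
    have := h.coeff_euler (IsNilpotent.exp (-a) * s) j
    rw [hD, map_zero, coeff_zero, ← nsmul_eq_mul, ← Nat.cast_smul_eq_nsmul ℂ] at this
    exact (smul_eq_zero_iff_right (by norm_cast; omega)).mp this.symm
  have := IsNilpotent.exp_mul_exp_neg_self hnil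
  linear_combination s * this - IsNilpotent.exp a * hone

theorem exp_nsmul {A : Type*} [CommRing A] [Module ℚ A] {a : A} (ha : IsNilpotent a) (n : ℕ) :
    IsNilpotent.exp (n • a) = IsNilpotent.exp a ^ n := by
  induction n with
  | zero => simp
  | succ n ih =>
    rw [succ_nsmul, IsNilpotent.exp_add_of_commute (Commute.all _ _) (ha.smul n) ha, ih, pow_succ]

/-- An element `e` with components `1` in degree `0` and `0` in degree `d` is `s - D s / d` for
some `s = exp a`, where `D` is the Euler derivation. With `r = exp (-a / d)`, the endomorphism
`x ↦ ∑ j, x_j r ^ j` followed by multiplication by `e` preserves the component of degree `d`: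
for `q = d - j > 0`, `e r ^ j = z - D z / q` with `z = exp (q a / d)` has no component of
degree `q`. -/
theorem exists_twist [Module ℚ A] (h : IsGradingMap θ d) (hd : 0 < d) {e : A}
    (he : (θ e).coeff 0 = 1) (hed : (θ e).coeff d = 0) :
    ∃ r, (θ r).coeff 0 = 1 ∧ ∀ x, (θ (aeval r (θ x) * e)).coeff d = (θ x).coeff d := by
  have hd0 : (d : ℂ) ≠ 0 := by exact_mod_cast hd.ne'
  obtain ⟨s, hs, hse⟩ : ∃ s, (θ s).coeff 0 = 1 ∧ s - (d : ℂ)⁻¹ • h.euler s = e := by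
    have key : ∀ j, (θ (∑ i ∈ range d, ((d : ℂ) / (d - i)) • (θ e).coeff i)).coeff j =
        ((d : ℂ) / (d - j)) • (θ e).coeff j := by
      intro j
      rw [map_sum, finsetSum_coeff]
      simp only [map_smul, coeff_smul, h.map_coeff, coeff_monomial]
      by_cases hj : j < d
      · rw [sum_eq_single_of_mem j (mem_range.mpr hj) (fun i _ hij => by simp [hij])]
        simp
      · rw [sum_eq_zero fun i hi => by
          rw [if_neg (by have := mem_range.mp hi; omega), smul_zero]]
        rcases eq_or_ne j d with rfl | hjd
        · simp
        · rw [coeff_eq_zero_of_natDegree_lt ((h.natDegree_le e).trans_lt (by omega)), smul_zero]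
    refine ⟨_, by rw [key]; simp [he, hd0], ?_⟩
    rw [← h.sum_coeff (_ - _), ← h.sum_coeff e]
    refine sum_congr rfl fun j hj => ?_
    rw [h.sum_coeff e, map_sub, map_smul, coeff_sub, coeff_smul, h.coeff_euler, key,
      ← nsmul_eq_mul, ← Nat.cast_smul_eq_nsmul ℂ, smul_smul, smul_smul, ← sub_smul]
    rcases eq_or_ne j d with rfl | hjd
    · simp [hed]
    · have : (d : ℂ) - j ≠ 0 := sub_ne_zero.mpr (by exact_mod_cast hjd.symm)
      conv_rhs => rw [← one_smul ℂ ((θ e).coeff j)]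
      congr 1
      field_simp
  obtain ⟨a, ha, rfl⟩ := h.exists_exp_eq hs
  have hb0 : (θ ((d : ℂ)⁻¹ • a)).coeff 0 = 0 := by simp [ha]
  set b := (d : ℂ)⁻¹ • a with hb
  have hbn := h.isNilpotent hb0
  have hab : a = d • b := by
    rw [hb, ← Nat.cast_smul_eq_nsmul ℂ, smul_inv_smul₀ hd0]
  have hr0 : (θ (IsNilpotent.exp (-b))).coeff 0 = 1 := h.coeff_zero_exp (by simp [hb0])
  refine ⟨IsNilpotent.exp (-b), hr0, fun x => ?_⟩
  refine h.induction_on x (fun y z hy hz => ?_) ?_ fun j hj y hy => ?_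
  · simp only [map_add, add_mul, coeff_add, hy, hz]
  · simp
  rw [hy, aeval_monomial, Algebra.algebraMap_self, RingHom.id_apply, mul_right_comm, mul_assoc,
    mul_comm, map_mul, hy]
  obtain ⟨q, rfl⟩ := Nat.exists_eq_add_of_le' hj
  rw [coeff_mul_monomial, coeff_monomial]
  rcases Nat.eq_zero_or_pos q with rfl | hq
  · rw [map_mul, mul_coeff_zero, he, one_mul, map_pow, coeff_zero_eq_eval_zero, eval_pow,
      ← coeff_zero_eq_eval_zero, hr0]
    simp
  · rw [if_neg (by omega)]
    have hX : IsNilpotent.exp a * IsNilpotent.exp (-b) ^ j = IsNilpotent.exp b ^ q := by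
      rw [hab, exp_nsmul hbn, pow_add, mul_assoc, ← mul_pow, IsNilpotent.exp_mul_exp_neg_self hbn,
        one_pow, mul_one]
    have hq0 : (q : ℂ) ≠ 0 := by exact_mod_cast hq.ne'
    have hez : e * IsNilpotent.exp (-b) ^ j =
        IsNilpotent.exp b ^ q - (q : ℂ)⁻¹ • h.euler (IsNilpotent.exp b ^ q) := by
      have hDq : h.euler (IsNilpotent.exp b ^ q) = (q : ℂ) • (IsNilpotent.exp b ^ q * h.euler b) := by
        rw [← exp_nsmul hbn, h.euler_exp (hbn.smul q), map_nsmul, mul_smul_comm,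
          Nat.cast_smul_eq_nsmul ℂ]
      rw [hDq, inv_smul_smul₀ hq0, ← hse, h.euler_exp (h.isNilpotent ha), ← mul_smul_comm,
        ← Derivation.map_smul, ← hb, sub_mul, hX, mul_right_comm, hX]
    rw [hez, map_sub, map_smul, coeff_sub, coeff_smul, h.coeff_euler, ← nsmul_eq_mul,
      ← Nat.cast_smul_eq_nsmul ℂ, inv_smul_smul₀ hq0, sub_self, zero_mul]

theorem aeval_injective (h : IsGradingMap θ d) {r : A} (hr : (θ r).coeff 0 = 1) {x : A}
    (hx : aeval r (θ x) = 0) : x = 0 := by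
  have key : ∀ j, (θ x).coeff j = 0 := by
    intro j
    induction j using Nat.strong_induction_on with
    | _ j ih =>
      by_cases hj : j ≤ d
      · have := congrArg (fun z => (θ z).coeff j) hx
        simp only [map_zero, coeff_zero] at this
        rw [aeval_eq_sum_range' (Nat.lt_succ_of_le (h.natDegree_le x)), map_sum,
          finsetSum_coeff, sum_eq_single_of_mem j (mem_range.mpr (by omega))] at this
        · rw [smul_eq_mul, map_mul, h.map_coeff, mul_comm] at this
          have h2 := coeff_mul_monomial (θ (r ^ j)) j 0 ((θ x).coeff j)
          rw [zero_add, this, map_pow, coeff_zero_eq_eval_zero, eval_pow,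
            ← coeff_zero_eq_eval_zero, hr, one_pow, one_mul] at h2
          exact h2.symm
        · intro i _ hij
          rcases lt_or_gt_of_ne hij with hlt | hgt
          · simp [ih i hlt]
          · rw [smul_eq_mul, map_mul, h.map_coeff, ← C_mul_X_pow_eq_monomial, mul_assoc,
              coeff_C_mul, coeff_X_pow_mul', if_neg (by omega), mul_zero]
      · exact coeff_eq_zero_of_natDegree_lt ((h.natDegree_le x).trans_lt (by omega))
  rw [← h.sum_coeff x]
  exact sum_eq_zero fun j _ => key j

end IsGradingMap

section Unitization

variable {N : Type*} [NonUnitalCommRing N] [Module ℂ N]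

/-- Linear maps that decompose each element along a direct sum are its projections. -/
theorem component_of_mem {G : ℕ → Submodule ℂ N} {d : ℕ} (hdirect : DirectSum.IsInternal G)
    {p : ℕ → N →ₗ[ℂ] N} (hp : ∀ j u, p j u ∈ G j) (hpsum : ∀ u, ∑ j ∈ Icc 1 d, p j u = u)
    {i j : ℕ} (hj : j ∈ Icc 1 d) {x : N} (hx : x ∈ G i) : p j x = if i = j then x else 0 := by
  have hz : ∑ k ∈ Icc 1 d, DirectSum.of (fun k => G k) k ⟨p k x, hp k x⟩ =
      DirectSum.of (fun k => G k) i ⟨x, hx⟩ := by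
    apply hdirect.injective
    simp [map_sum, hpsum]
  have := congrArg (fun z : DirectSum ℕ fun k => G k => (z j : N)) hz
  simp only [DirectSum.sum_apply, DirectSum.of_apply] at this
  rw [sum_eq_single_of_mem j hj fun k _ hk => by simp [hk]] at this
  split_ifs at this ⊢ with h <;> simp_all
  subst h
  simp

variable [SMulCommClass ℂ N N] [IsScalarTower ℂ N N]

/-- The grading of `N` extends to its unitization, with the scalars in degree `0`. -/
theorem exists_isGradingMap {G : ℕ → Submodule ℂ N} {d : ℕ}
    (hG : ∀ j, j ∉ Icc 1 d → G j = ⊥)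
    (hGmul : ∀ (j m : ℕ) (u v : N), u ∈ G j → v ∈ G m → u * v ∈ G (j + m))
    {p : ℕ → N →ₗ[ℂ] N} (hp : ∀ j u, p j u ∈ G j) (hpsum : ∀ u, ∑ j ∈ Icc 1 d, p j u = u)
    (hpG : ∀ i, ∀ j ∈ Icc 1 d, ∀ x ∈ G i, p j x = if i = j then x else 0) :
    ∃ θ : Unitization ℂ N →ₐ[ℂ] (Unitization ℂ N)[X], IsGradingMap θ d ∧
      ∀ x : N, θ x = ∑ j ∈ Icc 1 d, monomial j (p j x : Unitization ℂ N) := by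
  let θl : N →ₗ[ℂ] (Unitization ℂ N)[X] := ∑ j ∈ Icc 1 d,
    ((monomial j).restrictScalars ℂ).comp ((Unitization.inrHom ℂ ℂ N).comp (p j))
  have hθl : ∀ x, θl x = ∑ j ∈ Icc 1 d, monomial j (p j x : Unitization ℂ N) := fun x => by
    simp [θl]
  have hθG : ∀ i, ∀ x ∈ G i, θl x = monomial i (x : Unitization ℂ N) := fun i x hx => by
    rw [hθl]
    by_cases hi : i ∈ Icc 1 d
    · rw [sum_eq_single_of_mem i hi fun j hj hji => by simp [hpG i j hj x hx, hji.symm]]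
      simp [hpG i i hi x hx]
    · rw [hG i hi, Submodule.mem_bot] at hx
      simp [hx]
  have hmul : ∀ x y, θl (x * y) = θl x * θl y := fun x y => by
    conv_lhs => rw [← hpsum x, ← hpsum y, sum_mul_sum, map_sum]
    rw [hθl x, hθl y, sum_mul_sum]
    refine sum_congr rfl fun i _ => ?_
    rw [map_sum]
    refine sum_congr rfl fun j _ => ?_
    rw [hθG (i + j) _ (hGmul i j _ _ (hp i x) (hp j y)), monomial_mul_monomial,
      Unitization.inr_mul]
  let θ : Unitization ℂ N →ₐ[ℂ] (Unitization ℂ N)[X] := Unitization.lift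
    { θl with map_zero' := map_zero θl, map_mul' := hmul }
  have hθ : ∀ x : N, θ x = θl x := fun x => by
    simp [θ]
  have hind : ∀ {q : Unitization ℂ N → Prop}, (∀ c : ℂ, q (algebraMap ℂ _ c)) →
      (∀ i ∈ Icc 1 d, ∀ x ∈ G i, q (x : Unitization ℂ N)) →
      (∀ x y, q x → q y → q (x + y)) → ∀ x, q x := fun h1 h2 h3 x => by
    induction x with
    | inl_add_inr c x =>
      refine h3 _ _ (h1 c) ?_
      rw [← hpsum x, ← Unitization.inrHom_apply ℂ, map_sum]
      refine Finset.sum_induction _ _ h3 (by simpa using h1 0) fun j hj => h2 j hj _ (hp j x)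
  refine ⟨θ, ⟨fun x => ?_, fun x j => ?_, fun x => ?_⟩, fun x => by rw [hθ, hθl]⟩
  · refine hind (q := fun x => (θ x).eval 1 = x) (fun c => ?_) (fun i _ y hy => ?_)
      (fun y z hy hz => ?_) x
    · simp [AlgHom.commutes, Polynomial.algebraMap_apply]
    · simp [hθ, hθG i y hy]
    · simp [hy, hz]
  · refine hind (q := fun x => θ ((θ x).coeff j) = monomial j ((θ x).coeff j)) (fun c => ?_)
      (fun i _ y hy => ?_) (fun y z hy hz => ?_) x
    · rw [AlgHom.commutes, Polynomial.algebraMap_apply, coeff_C]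
      split_ifs with hj
      · simp [hj, AlgHom.commutes, Polynomial.algebraMap_apply]
      · simp
    · rw [hθ, hθG i y hy, coeff_monomial]
      split_ifs with hj
      · rw [hθ, hθG i y hy, hj]
      · simp
    · simp [hy, hz]
  · refine hind (q := fun x => (θ x).natDegree ≤ d) (fun c => ?_) (fun i hi y hy => ?_)
      (fun y z hy hz => ?_) x
    · simp [AlgHom.commutes, Polynomial.algebraMap_apply]
    · rw [hθ, hθG i y hy]
      exact (natDegree_monomial_le _).trans (mem_Icc.mp hi).2
    · rw [map_add]
      exact natDegree_add_le_of_degree_le hy hz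

theorem inr_upow_succ (u : N) (m : ℕ) :
    ((upow u (m + 1) : N) : Unitization ℂ N) = (u : Unitization ℂ N) ^ (m + 1) := by
  induction m with
  | zero => simp [upow]
  | succ m ih => rw [upow, Unitization.inr_mul, ih, ← pow_succ']

end Unitization

/-- For a graded admissible algebra `N = ⊕_{j=1}^d N_j` with `π` the
projection onto `N_d = Ann(N)` and `f = π ∘ exp₁`, the group `A(f)` of affine
transformations `g` of `N` with `f ∘ g = f` acts transitively on `S = f⁻¹(0)`:
for any `u, v ∈ S` there is an invertible affine map `w ↦ L(w) + b` preserving `f`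
which sends `u` to `v`. -/
theorem stmt8 (N : Type*) [NonUnitalCommRing N] [Module ℂ N] [SMulCommClass ℂ N N]
    [IsScalarTower ℂ N N] [FiniteDimensional ℂ N]
    (ν : ℕ) (hnil : npow N (ν + 1) = ⊥) (hann : Module.finrank ℂ (annN N) = 1)
    (G : ℕ → Submodule ℂ N) (d : ℕ)
    (hG0 : G 0 = ⊥) (hGd : G d = annN N) (hGtop : ∀ j : ℕ, d < j → G j = ⊥)
    (hGmul : ∀ (j m : ℕ) (u v : N), u ∈ G j → v ∈ G m → u * v ∈ G (j + m))
    (hdirect : DirectSum.IsInternal G)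
    (p : ℕ → (N →ₗ[ℂ] N)) (hp : ∀ (j : ℕ) (u : N), p j u ∈ G j)
    (hpsum : ∀ u : N, ∑ j ∈ Finset.Icc 1 d, p j u = u)
    (f : N → N)
    (hf : ∀ u : N, f u = p d (∑ m ∈ Finset.Icc 1 d, ((Nat.factorial m : ℂ))⁻¹ • upow u m)) :
    ∀ u v : N, f u = 0 → f v = 0 →
      ∃ (L : N ≃ₗ[ℂ] N) (b : N), (∀ w : N, f (L w + b) = f w) ∧ L u + b = v := by
  have hd : 0 < d := by
    rcases Nat.eq_zero_or_pos d with rfl | hd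
    · rw [← hGd, hG0, finrank_bot] at hann
      exact absurd hann (by norm_num)
    · exact hd
  have hG : ∀ j, j ∉ Icc 1 d → G j = ⊥ := fun j hj => by
    rcases Nat.eq_zero_or_pos j with rfl | hj0
    · exact hG0
    · exact hGtop j (by rw [mem_Icc] at hj; omega)
  obtain ⟨θ, hθ, hθN⟩ := exists_isGradingMap hG hGmul hp hpsum
    fun i j hj x hx => component_of_mem hdirect hp hpsum hj hx
  let _ : Module ℚ (Unitization ℂ N) := Module.compHom _ (algebraMap ℚ ℂ)
  have hθ0 : ∀ x : N, (θ x).coeff 0 = 0 := fun x => by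
    rw [hθN, finsetSum_coeff]
    exact sum_eq_zero fun j hj => coeff_monomial_of_ne _ (by rw [mem_Icc] at hj; omega)
  have hθd : ∀ x : N, (θ x).coeff d = (p d x : Unitization ℂ N) := fun x => by
    rw [hθN, finsetSum_coeff, sum_eq_single_of_mem d (by simp; omega)
      fun j _ hj => coeff_monomial_of_ne _ hj.symm, coeff_monomial_same]
  have hfexp : ∀ w : N, (f w : Unitization ℂ N) =
      (θ (IsNilpotent.exp (w : Unitization ℂ N))).coeff d := by
    intro w
    have hexp : IsNilpotent.exp (w : Unitization ℂ N) = 1 +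
        ((∑ m ∈ Icc 1 d, ((Nat.factorial m : ℂ))⁻¹ • upow w m : N) : Unitization ℂ N) := by
      rw [IsNilpotent.exp_eq_sum (hθ.pow_eq_zero (hθ0 w)), sum_range_succ', add_comm]
      congr 1
      · simp
      · rw [range_eq_Ico, sum_Ico_add' (fun m => ((Nat.factorial m : ℚ))⁻¹ •
          (w : Unitization ℂ N) ^ m) 0 d 1, ← Unitization.inrHom_apply ℂ ℂ N (∑ m ∈ _, _), map_sum]
        refine sum_congr (by ext; simp) fun m hm => ?_
        obtain ⟨k, rfl⟩ := Nat.exists_eq_add_of_le' (mem_Icc.mp hm).1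
        rw [map_smul, Unitization.inrHom_apply, inr_upow_succ, inv_natCast_smul_eq ℚ ℂ]
    rw [hexp, hf, ← hθd, map_add, coeff_add, map_one, coeff_one, if_neg hd.ne', zero_add]
  have htrans : ∀ u : N, f u = 0 → ∃ L : N ≃ₗ[ℂ] N, ∀ w, f (L w + u) = f w := by
    intro u hu
    obtain ⟨r, hr, hrd⟩ := hθ.exists_twist hd (hθ.coeff_zero_exp (hθ0 u))
      (by rw [← hfexp, hu, Unitization.inr_zero])
    let φ : Unitization ℂ N →ₐ[ℂ] Unitization ℂ N := ((aeval r).restrictScalars ℂ).comp θ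
    let L : N →ₗ[ℂ] N := (Unitization.sndHom ℂ ℂ N).comp
      (φ.toLinearMap.comp (Unitization.inrHom ℂ ℂ N))
    have hL : ∀ w : N, (L w : Unitization ℂ N) = φ w := fun w => by
      refine Unitization.ext ?_ rfl
      change 0 = Unitization.fstHom ℂ N (aeval r (θ w))
      rw [hθN, map_sum, map_sum]
      exact (sum_eq_zero fun j _ => by simp [aeval_monomial]).symm
    have hinj : Function.Injective L := by
      refine (injective_iff_map_eq_zero L).mpr fun w hw => ?_
      refine Unitization.inr_injective (R := ℂ) (hθ.aeval_injective hr ?_)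
      exact (hL w).symm.trans (by rw [hw, Unitization.inr_zero])
    refine ⟨LinearEquiv.ofInjectiveEndo L hinj, fun w => Unitization.inr_injective (R := ℂ) ?_⟩
    have hnil : ∀ x : N, IsNilpotent (x : Unitization ℂ N) := fun x => hθ.isNilpotent (hθ0 x)
    rw [LinearEquiv.coe_ofInjectiveEndo, hfexp, hfexp, Unitization.inr_add,
      IsNilpotent.exp_add_of_commute (Commute.all _ _) (hnil _) (hnil _), hL,
      ← (hnil w).map_exp φ]
    exact hrd _
  intro u v hu hv
  obtain ⟨Lu, hLu⟩ := htrans u hu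
  obtain ⟨Lv, hLv⟩ := htrans v hv
  refine ⟨Lu.symm.trans Lv, v - Lv (Lu.symm u), fun w => ?_, by simp⟩
  have h1 : (Lu.symm.trans Lv) w + (v - Lv (Lu.symm u)) = Lv (Lu.symm (w - u)) + v := by
    simp only [LinearEquiv.trans_apply, map_sub]
    abel
  rw [h1, hLv, ← hLu, LinearEquiv.apply_symm_apply, sub_add_cancel]
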